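/- Let v : ℝ × ℝ → ℝ be defined by v(t,s) = ((2/3)·π·exp(−π²t/3)·sin(πs/3)) / (5 + exp(−π²t/3)·cos(πs/3)). Then for every t ≥ 0 and every s ∈ ℝ, v satisfies ∂v/∂t + 3·v·∂v/∂s = 3·∂²v/∂s² at the point (t,s). -/

import Mathlib

open Real

/-- The one-dimensional profile of the paper's exact Burgers solution:
`v(t,s) = ((2/3)·π·exp(−π²t/3)·sin(πs/3)) / (5 + exp(−π²t/3)·cos(πs/3))`. -/
noncomputable def vBurgers : ℝ × ℝ → ℝ :=
  fun p =>
    ((2 / 3) * π * Real.exp (-π ^ 2 * p.1 / 3) * Real.sin (π * p.2 / 3)) /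
      (5 + Real.exp (-π ^ 2 * p.1 / 3) * Real.cos (π * p.2 / 3))

lemma vBurgers_denom_pos {t : ℝ} (ht : 0 ≤ t) (s : ℝ) :
    0 < 5 + Real.exp (-π ^ 2 * t / 3) * Real.cos (π * s / 3) := by
  have hexp : Real.exp (-π ^ 2 * t / 3) ≤ 1 := by
    rw [Real.exp_le_one_iff]
    have : 0 ≤ π ^ 2 * t := by positivity
    linarith
  nlinarith [Real.exp_pos (-π ^ 2 * t / 3), Real.neg_one_le_cos (π * s / 3)]

lemma hasDerivAt_pi_mul_div_three (s : ℝ) :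
    HasDerivAt (fun σ : ℝ => π * σ / 3) (π / 3) s := by
  simpa using ((hasDerivAt_id s).const_mul π).div_const 3

lemma hasDerivAt_vBurgers_time {t : ℝ} (ht : 0 ≤ t) (s : ℝ) :
    HasDerivAt (fun τ => vBurgers (τ, s))
      (-(10 / 9) * π ^ 3 * Real.exp (-π ^ 2 * t / 3) * Real.sin (π * s / 3) /
        (5 + Real.exp (-π ^ 2 * t / 3) * Real.cos (π * s / 3)) ^ 2) t := by
  have hlin : HasDerivAt (fun τ : ℝ => -π ^ 2 * τ / 3) (-π ^ 2 / 3) t := by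
    simpa using ((hasDerivAt_id t).const_mul (-π ^ 2)).div_const 3
  have h := ((hlin.exp.const_mul ((2 / 3) * π)).mul_const (Real.sin (π * s / 3))).fun_div
    ((hlin.exp.mul_const (Real.cos (π * s / 3))).const_add 5) (vBurgers_denom_pos ht s).ne'
  refine h.congr_deriv ?_
  congr 1
  ring

lemma hasDerivAt_vBurgers_space {t : ℝ} (ht : 0 ≤ t) (s : ℝ) :
    HasDerivAt (fun σ => vBurgers (t, σ))
      ((2 / 9) * π ^ 2 * Real.exp (-π ^ 2 * t / 3) *
          (5 * Real.cos (π * s / 3) + Real.exp (-π ^ 2 * t / 3)) /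
        (5 + Real.exp (-π ^ 2 * t / 3) * Real.cos (π * s / 3)) ^ 2) s := by
  have hlin := hasDerivAt_pi_mul_div_three s
  have h := (hlin.sin.const_mul ((2 / 3) * π * Real.exp (-π ^ 2 * t / 3))).fun_div
    ((hlin.cos.const_mul (Real.exp (-π ^ 2 * t / 3))).const_add 5) (vBurgers_denom_pos ht s).ne'
  refine h.congr_deriv ?_
  congr 1
  linear_combination (2 / 9) * π ^ 2 * Real.exp (-π ^ 2 * t / 3) ^ 2 *
    Real.sin_sq_add_cos_sq (π * s / 3)

/-- `vBurgers` satisfies `∂v/∂t + 3·v·∂v/∂s = 3·∂²v/∂s²` at every point `(t,s)`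
with `t ≥ 0`. -/
theorem vBurgers_satisfies_1d_burgers (t s : ℝ) (ht : 0 ≤ t) :
    deriv (fun τ => vBurgers (τ, s)) t +
      3 * vBurgers (t, s) * deriv (fun σ => vBurgers (t, σ)) s =
    3 * deriv (deriv (fun σ => vBurgers (t, σ))) s := by
  have hD := (vBurgers_denom_pos ht s).ne'
  have hlin := hasDerivAt_pi_mul_div_three s
  have hss := (((hlin.cos.const_mul 5).add_const (Real.exp (-π ^ 2 * t / 3))).const_mul
    ((2 / 9) * π ^ 2 * Real.exp (-π ^ 2 * t / 3))).fun_div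
    (((hlin.cos.const_mul (Real.exp (-π ^ 2 * t / 3))).const_add 5).fun_pow 2) (pow_ne_zero 2 hD)
  rw [funext fun σ => (hasDerivAt_vBurgers_space ht σ).deriv, hss.deriv,
    (hasDerivAt_vBurgers_time ht s).deriv]
  simp only [vBurgers]
  generalize Real.exp (-π ^ 2 * t / 3) = E at *
  generalize Real.cos (π * s / 3) = C at *
  generalize Real.sin (π * s / 3) = S at *
  field_simp
  ring
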